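/- (Proposition on general parametric families, part (ii).) Under the same assumptions (a) and (b) as in part (i) — M = {P_θ : θ ∈ Θ} ⊆ measures on ℝ^d with finite p-th moment, θ ↦ P_θ one-to-one and W_p-continuous on the metric space (Θ, ρ), estimator θ̂_n weakly consistent locally uniformly in θ — define the test statistic T_{M,n} = W_p^p(P̂_n, P_{θ̂_n}), the null distribution function F_{n,θ}(t) = P_θⁿ[T_{M,n} ≤ t], and the critical value c_M(α, n, θ) = inf{t ≥ 0 : F_{n,θ}(t) ≥ 1−α} for α ∈ (0,1). Then the critical values tend to zero uniformly on compacts: for every α > 0 and every compact K ⊆ Θ, lim_{n→∞} sup_{θ∈K} c_M(α, n, θ) = 0. -/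

import Mathlib

open MeasureTheory ENNReal Filter Topology

noncomputable section

/-- `ℝ^d` as Euclidean space. -/
abbrev Euc (d : ℕ) : Type := EuclideanSpace ℝ (Fin d)

/-- The set of couplings of two Borel probability measures: probability measures on the
product space whose first marginal is `P` and second marginal is `Q`. -/
def couplings {E : Type*} [MeasurableSpace E] (P Q : Measure E) : Set (Measure (E × E)) :=
  {γ | IsProbabilityMeasure γ ∧ γ.map Prod.fst = P ∧ γ.map Prod.snd = Q}

/-- `W_p^p(P,Q)`: the `p`-th power of the `p`-Wasserstein distance,
`inf_{γ ∈ Γ(P,Q)} ∫ ‖x - y‖^p dγ(x,y)`, as an extended nonnegative real. -/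
def WpPow {E : Type*} [MeasurableSpace E] [NormedAddCommGroup E] (p : ℝ) (P Q : Measure E) :
    ℝ≥0∞ :=
  ⨅ γ ∈ couplings P Q, ∫⁻ z, ENNReal.ofReal (‖z.1 - z.2‖ ^ p) ∂γ

/-- The `p`-Wasserstein distance `W_p(P,Q)`. -/
def Wp {E : Type*} [MeasurableSpace E] [NormedAddCommGroup E] (p : ℝ) (P Q : Measure E) :
    ℝ≥0∞ :=
  WpPow p P Q ^ (1 / p)

/-- Empirical distribution `n⁻¹ ∑ᵢ δ_{x i}` of `n` points. -/
def empDist {E : Type*} [MeasurableSpace E] {n : ℕ} (x : Fin n → E) : Measure E :=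
  (n : ℝ≥0∞)⁻¹ • ∑ i, Measure.dirac (x i)

/-- The `n`-fold product measure `P^n` on `(ℝ^d)^n`. -/
def prodn {E : Type*} [MeasurableSpace E] (P : Measure E) (n : ℕ) : Measure (Fin n → E) :=
  Measure.pi fun _ => P

/-- `P` has a finite moment of order `p`. -/
def HasFinMom {E : Type*} [MeasurableSpace E] [NormedAddCommGroup E] (p : ℝ) (P : Measure E) :
    Prop :=
  ∫⁻ x, ENNReal.ofReal (‖x‖ ^ p) ∂P ≠ ∞

open ProbabilityTheory in
lemma cost_tri {d : ℕ} {p : ℝ} (hp : 1 ≤ p) (x y z : Euc d) :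
    ENNReal.ofReal (‖x - z‖ ^ p) ≤ ENNReal.ofReal (2 ^ (p - 1)) *
      (ENNReal.ofReal (‖x - y‖ ^ p) + ENNReal.ofReal (‖y - z‖ ^ p)) := by
  have h0 : 0 ≤ p := by linarith
  rw [← ENNReal.ofReal_rpow_of_nonneg (norm_nonneg _) h0,
    ← ENNReal.ofReal_rpow_of_nonneg (norm_nonneg _) h0,
    ← ENNReal.ofReal_rpow_of_nonneg (norm_nonneg _) h0]
  have h2 : ENNReal.ofReal (2 ^ (p - 1)) = 2 ^ (p - 1) := by
    rw [← ENNReal.ofReal_rpow_of_pos (by norm_num)]; simp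
  rw [h2]
  refine le_trans ?_ (ENNReal.rpow_add_le_mul_rpow_add_rpow _ _ hp)
  refine ENNReal.rpow_le_rpow ?_ h0
  rw [← ENNReal.ofReal_add (norm_nonneg _) (norm_nonneg _)]
  exact ENNReal.ofReal_le_ofReal (norm_sub_le_norm_sub_add_norm_sub x y z)

lemma meas_cost {d : ℕ} (p : ℝ) :
    Measurable fun z : Euc d × Euc d => ENNReal.ofReal (‖z.1 - z.2‖ ^ p) := by
  fun_prop

lemma wpPow_le {d : ℕ} {p : ℝ} {P Q : Measure (Euc d)} {γ : Measure (Euc d × Euc d)}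
    (h : γ ∈ couplings P Q) :
    WpPow p P Q ≤ ∫⁻ z, ENNReal.ofReal (‖z.1 - z.2‖ ^ p) ∂γ :=
  iInf₂_le γ h

lemma swap_mem {d : ℕ} {P Q : Measure (Euc d)} {γ : Measure (Euc d × Euc d)}
    (h : γ ∈ couplings P Q) : γ.map Prod.swap ∈ couplings Q P := by
  obtain ⟨h1, h2, h3⟩ := h
  refine ⟨Measure.isProbabilityMeasure_map (by fun_prop), ?_, ?_⟩
  · rw [Measure.map_map (by fun_prop) (by fun_prop)]; exact h3
  · rw [Measure.map_map (by fun_prop) (by fun_prop)]; exact h2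

lemma wpPow_symm_le {d : ℕ} (p : ℝ) (P Q : Measure (Euc d)) : WpPow p P Q ≤ WpPow p Q P := by
  refine le_iInf₂ fun γ hγ => ?_
  refine (wpPow_le (swap_mem hγ)).trans (le_of_eq ?_)
  rw [lintegral_map (meas_cost p) (by fun_prop)]
  refine lintegral_congr fun z => ?_
  simp [norm_sub_rev]

lemma wpPow_symm {d : ℕ} (p : ℝ) (P Q : Measure (Euc d)) : WpPow p P Q = WpPow p Q P :=
  le_antisymm (wpPow_symm_le p P Q) (wpPow_symm_le p Q P)

open ProbabilityTheory in
/-- Gluing lemma. -/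
lemma glue {d : ℕ} {P Q R : Measure (Euc d)} {γ₁ γ₂ : Measure (Euc d × Euc d)}
    (h₁ : γ₁ ∈ couplings P Q) (h₂ : γ₂ ∈ couplings Q R) :
    ∃ Γ : Measure (Euc d × (Euc d × Euc d)), IsProbabilityMeasure Γ ∧
      Γ.map (fun z => (z.2.1, z.1)) = γ₁ ∧ Γ.map (fun z => (z.1, z.2.2)) = γ₂ := by
  have h₃ := swap_mem h₁
  have e1 : (γ₁.map Prod.swap).map Prod.swap = γ₁ := by
    rw [Measure.map_map (by fun_prop) (by fun_prop)]; simp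
  generalize γ₁.map Prod.swap = γ₃ at h₃ e1
  obtain ⟨i3, a3, b3⟩ := h₃
  obtain ⟨i2, a2, b2⟩ := h₂
  have hQ : IsProbabilityMeasure Q := by
    rw [← a2]; exact Measure.isProbabilityMeasure_map (by fun_prop)
  have d3 : Q ⊗ₘ γ₃.condKernel = γ₃ := by
    conv_rhs => rw [← γ₃.disintegrate γ₃.condKernel]
    rw [Measure.fst, a3]
  have d2 : Q ⊗ₘ γ₂.condKernel = γ₂ := by
    conv_rhs => rw [← γ₂.disintegrate γ₂.condKernel]
    rw [Measure.fst, a2]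
  have m3 : (Q ⊗ₘ (γ₃.condKernel ×ₖ γ₂.condKernel)).map (Prod.map id Prod.fst) = γ₃ := by
    rw [← Measure.compProd_map (by fun_prop), ← Kernel.fst_eq, Kernel.fst_prod, d3]
  have m2 : (Q ⊗ₘ (γ₃.condKernel ×ₖ γ₂.condKernel)).map (Prod.map id Prod.snd) = γ₂ := by
    rw [← Measure.compProd_map (by fun_prop), ← Kernel.snd_eq, Kernel.snd_prod, d2]
  refine ⟨Q ⊗ₘ (γ₃.condKernel ×ₖ γ₂.condKernel), inferInstance, ?_, ?_⟩
  · have := congrArg (Measure.map Prod.swap) m3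
    rw [e1, Measure.map_map (by fun_prop) (by fun_prop)] at this
    exact this
  · exact m2

lemma wpPow_tri {d : ℕ} {p : ℝ} (hp : 1 ≤ p) (P Q R : Measure (Euc d)) :
    WpPow p P R ≤ ENNReal.ofReal (2 ^ (p - 1)) * (WpPow p P Q + WpPow p Q R) := by
  have key : ∀ γ₁ ∈ couplings P Q, ∀ γ₂ ∈ couplings Q R, WpPow p P R ≤
      ENNReal.ofReal (2 ^ (p - 1)) * ((∫⁻ z, ENNReal.ofReal (‖z.1 - z.2‖ ^ p) ∂γ₁)
        + ∫⁻ z, ENNReal.ofReal (‖z.1 - z.2‖ ^ p) ∂γ₂) := by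
    intro γ₁ h₁ γ₂ h₂
    obtain ⟨Γ, hΓ, m1, m2⟩ := glue h₁ h₂
    have hc : Γ.map Prod.snd ∈ couplings P R := by
      refine ⟨Measure.isProbabilityMeasure_map (by fun_prop), ?_, ?_⟩
      · rw [← h₁.2.1, ← m1, Measure.map_map (by fun_prop) (by fun_prop),
          Measure.map_map (by fun_prop) (by fun_prop)]; rfl
      · rw [← h₂.2.2, ← m2, Measure.map_map (by fun_prop) (by fun_prop),
          Measure.map_map (by fun_prop) (by fun_prop)]; rfl
    refine (wpPow_le hc).trans ?_
    rw [← m1, ← m2, lintegral_map (meas_cost p) (by fun_prop),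
      lintegral_map (meas_cost p) (by fun_prop), lintegral_map (meas_cost p) (by fun_prop),
      ← lintegral_add_left (by fun_prop), ← lintegral_const_mul _ (by fun_prop)]
    exact lintegral_mono fun z => cost_tri hp _ _ _
  have hC0 : ENNReal.ofReal (2 ^ (p - 1)) ≠ 0 := by
    have : (0:ℝ) < 2 ^ (p - 1) := by positivity
    simpa using this
  have hC : ENNReal.ofReal (2 ^ (p - 1)) ≠ ∞ := ENNReal.ofReal_ne_top
  rw [mul_comm, ← ENNReal.div_le_iff hC0 hC]
  unfold WpPow at *
  simp only [ENNReal.iInf_add, ENNReal.add_iInf]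
  refine le_iInf fun γ₂ => le_iInf fun h₂ => le_iInf fun γ₁ => le_iInf fun h₁ => ?_
  rw [ENNReal.div_le_iff hC0 hC, mul_comm]
  exact key γ₁ h₁ γ₂ h₂

lemma wpPow_map {d : ℕ} (p : ℝ) (P : Measure (Euc d)) [IsProbabilityMeasure P]
    {T : Euc d → Euc d} (hT : Measurable T) :
    WpPow p P (P.map T) ≤ ∫⁻ x, ENNReal.ofReal (‖x - T x‖ ^ p) ∂P := by
  have hc : P.map (fun x => (x, T x)) ∈ couplings P (P.map T) := by
    refine ⟨Measure.isProbabilityMeasure_map (by fun_prop), ?_, ?_⟩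
    · rw [Measure.map_map (by fun_prop) (by fun_prop)]; exact Measure.map_id
    · rw [Measure.map_map (by fun_prop) (by fun_prop)]; rfl
  refine (wpPow_le hc).trans (le_of_eq ?_)
  rw [lintegral_map (meas_cost p) (by fun_prop)]

/-- TV-type bound. -/
lemma wpPow_tv {d : ℕ} (p : ℝ) (m μ ν : Measure (Euc d))
    [IsFiniteMeasure m] [IsFiniteMeasure μ] [IsFiniteMeasure ν] [IsProbabilityMeasure (m + μ)]
    (hmass : μ Set.univ = ν Set.univ) (D : ℝ≥0∞)
    (hD : ∀ᵐ x ∂μ, ∀ᵐ y ∂ν, ENNReal.ofReal (‖x - y‖ ^ p) ≤ D) (hp : 1 ≤ p) :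
    WpPow p (m + μ) (m + ν) ≤ D * μ Set.univ := by
  set t := μ Set.univ with ht
  have htop : t ≠ ∞ := measure_ne_top _ _
  have hf : (t⁻¹ • (μ.prod ν)).map Prod.fst = μ := by
    rw [Measure.map_smul, Measure.map_fst_prod, ← hmass, smul_smul]
    by_cases h0 : t = 0
    · rw [Measure.measure_univ_eq_zero.1 h0]; simp
    · rw [ENNReal.inv_mul_cancel h0 htop, one_smul]
  have hs : (t⁻¹ • (μ.prod ν)).map Prod.snd = ν := by
    rw [Measure.map_smul, Measure.map_snd_prod, ← ht, smul_smul]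
    by_cases h0 : t = 0
    · have hν0 : ν = 0 := Measure.measure_univ_eq_zero.1 (hmass.symm.trans h0)
      rw [hν0]; simp
    · rw [ENNReal.inv_mul_cancel h0 htop, one_smul]
  have hc : m.map (fun x => (x, x)) + t⁻¹ • (μ.prod ν) ∈ couplings (m + μ) (m + ν) := by
    have hfst : (m.map (fun x => (x, x)) + t⁻¹ • (μ.prod ν)).map Prod.fst = m + μ := by
      rw [Measure.map_add _ _ (by fun_prop), hf, Measure.map_map (by fun_prop) (by fun_prop)]
      congr 1; exact Measure.map_id
    refine ⟨⟨?_⟩, hfst, ?_⟩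
    · have : (m.map (fun x => (x, x)) + t⁻¹ • (μ.prod ν)) Set.univ = (m + μ) Set.univ := by
        rw [← hfst, Measure.map_apply (by fun_prop) .univ, Set.preimage_univ]
      rw [this]; exact measure_univ
    · rw [Measure.map_add _ _ (by fun_prop), hs, Measure.map_map (by fun_prop) (by fun_prop)]
      congr 1; exact Measure.map_id
  refine (wpPow_le hc).trans ?_
  rw [lintegral_add_measure, lintegral_map (meas_cost p) (by fun_prop), lintegral_smul_measure,
    lintegral_prod _ (meas_cost p).aemeasurable]
  have z : (∫⁻ a, ENNReal.ofReal (‖(a, a).1 - (a, a).2‖ ^ p) ∂m : ℝ≥0∞) = 0 := by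
    simp [Real.zero_rpow (by linarith : p ≠ 0)]
  rw [z, zero_add]
  calc t⁻¹ • ∫⁻ x, ∫⁻ y, ENNReal.ofReal (‖(x, y).1 - (x, y).2‖ ^ p) ∂ν ∂μ
      ≤ t⁻¹ • ∫⁻ x, ∫⁻ y, D ∂ν ∂μ := by
        gcongr ?_ • ?_
        refine lintegral_mono_ae ?_
        filter_upwards [hD] with x hx
        exact lintegral_mono_ae hx
    _ = t⁻¹ * (D * t * t) := by rw [lintegral_const, lintegral_const, ← hmass, ← ht, smul_eq_mul]
    _ ≤ D * t := by
        by_cases h0 : t = 0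
        · simp [h0]
        · rw [mul_comm (D * t), ← mul_assoc, ENNReal.inv_mul_cancel h0 htop, one_mul]

/-- Bound for images under a simple function. -/
lemma wpPow_simple {d : ℕ} {p : ℝ} (hp : 1 ≤ p) (P Q : Measure (Euc d)) [IsProbabilityMeasure P]
    [IsProbabilityMeasure Q] (T : SimpleFunc (Euc d) (Euc d)) (D : ℝ≥0∞)
    (hD : ∀ x ∈ T.range, ∀ y ∈ T.range, ENNReal.ofReal (‖x - y‖ ^ p) ≤ D) :
    WpPow p (P.map T) (Q.map T) ≤ D * ∑ j ∈ T.range, (P (T ⁻¹' {j}) - Q (T ⁻¹' {j})) := by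
  have rep : ∀ P : Measure (Euc d), P.map T = ∑ j ∈ T.range, P (T ⁻¹' {j}) • Measure.dirac j := by
    intro P
    ext s hs
    rw [Measure.map_apply T.measurable hs]
    simp only [Measure.coe_finsetSum, Measure.coe_smul, Finset.sum_apply, Pi.smul_apply,
      smul_eq_mul, Measure.dirac_apply' _ hs]
    have : T ⁻¹' s = ⋃ j ∈ T.range, (T ⁻¹' {j} ∩ T ⁻¹' s) := by
      ext x; simp
    rw [this, measure_biUnion_finset]
    · refine Finset.sum_congr rfl fun j _ => ?_
      by_cases hj : j ∈ s
      · have : T ⁻¹' {j} ∩ T ⁻¹' s = T ⁻¹' {j} := by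
          ext x; simp only [Set.mem_inter_iff, Set.mem_preimage, Set.mem_singleton_iff]
          constructor
          · exact fun h => h.1
          · exact fun h => ⟨h, h ▸ hj⟩
        simp [this, hj]
      · have : T ⁻¹' {j} ∩ T ⁻¹' s = ∅ := by
          ext x; simp only [Set.mem_inter_iff, Set.mem_preimage, Set.mem_singleton_iff,
            Set.mem_empty_iff_false, iff_false]
          rintro ⟨h, h'⟩; exact hj (h ▸ h')
        simp [this, hj]
    · intro i _ j _ hij
      refine Set.disjoint_left.2 ?_
      rintro x ⟨h, _⟩ ⟨h', _⟩
      exact hij (h.symm.trans h')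
    · exact fun j _ => (T.measurableSet_preimage _).inter (T.measurable hs)
  set a := fun j => P (T ⁻¹' {j}) with ha
  set b := fun j => Q (T ⁻¹' {j}) with hb
  have haf : ∀ j, a j ≠ ∞ := fun j => measure_ne_top _ _
  have hbf : ∀ j, b j ≠ ∞ := fun j => measure_ne_top _ _
  set m : Measure (Euc d) := ∑ j ∈ T.range, min (a j) (b j) • Measure.dirac j with hm
  set μ : Measure (Euc d) := ∑ j ∈ T.range, (a j - b j) • Measure.dirac j with hμ
  set ν : Measure (Euc d) := ∑ j ∈ T.range, (b j - a j) • Measure.dirac j with hν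
  have e1 : P.map T = m + μ := by
    rw [rep P, hm, hμ, ← Finset.sum_add_distrib]
    refine Finset.sum_congr rfl fun j _ => ?_
    rw [← add_smul]
    congr 1
    change a j = _
    rcases le_total (a j) (b j) with h | h
    · simp [h, tsub_eq_zero_of_le h]
    · simp [h, tsub_eq_zero_of_le h]
  have e2 : Q.map T = m + ν := by
    rw [rep Q, hm, hν, ← Finset.sum_add_distrib]
    refine Finset.sum_congr rfl fun j _ => ?_
    rw [← add_smul]
    congr 1
    change b j = _
    rcases le_total (a j) (b j) with h | h
    · simp [h, tsub_eq_zero_of_le h]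
    · simp [h, tsub_eq_zero_of_le h]
  have hPT : IsProbabilityMeasure (P.map T) :=
    Measure.isProbabilityMeasure_map T.measurable.aemeasurable
  have hQT : IsProbabilityMeasure (Q.map T) :=
    Measure.isProbabilityMeasure_map T.measurable.aemeasurable
  rw [e1] at hPT ⊢
  rw [e2] at hQT ⊢
  have fm : IsFiniteMeasure m := by
    refine ⟨lt_of_le_of_lt (b := (m + μ) Set.univ) ?_ (measure_lt_top _ _)⟩
    rw [Measure.add_apply]
    first | exact le_self_add | exact le_add_self
  have fμ : IsFiniteMeasure μ := by
    refine ⟨lt_of_le_of_lt (b := (m + μ) Set.univ) ?_ (measure_lt_top _ _)⟩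
    rw [Measure.add_apply]
    first | exact le_self_add | exact le_add_self
  have fν : IsFiniteMeasure ν := by
    refine ⟨lt_of_le_of_lt (b := (m + ν) Set.univ) ?_ (measure_lt_top _ _)⟩
    rw [Measure.add_apply]
    first | exact le_self_add | exact le_add_self
  have hmass : μ Set.univ = ν Set.univ := by
    have h : (m + μ) Set.univ = (m + ν) Set.univ := by simp only [measure_univ]
    simp only [Measure.coe_add, Pi.add_apply] at h
    exact (ENNReal.add_right_inj (measure_ne_top m _)).1 h
  have aux : ∀ (c : Euc d → ℝ≥0∞) , ∀ᵐ x ∂(∑ j ∈ T.range, c j • Measure.dirac j), x ∈ T.range := by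
    intro c
    rw [ae_iff]
    simp only [Measure.coe_finsetSum, Finset.sum_apply, Measure.coe_smul, Pi.smul_apply]
    refine Finset.sum_eq_zero fun j hj => ?_
    rw [Measure.dirac_apply]
    have : j ∉ {a | ¬ a ∈ T.range} := by simpa using hj
    rw [Set.indicator_of_notMem this]; simp
  have := wpPow_tv p m μ ν hmass D (by
    filter_upwards [aux _] with x hx
    filter_upwards [aux _] with y hy
    exact hD x hx y hy) hp
  refine this.trans (le_of_eq ?_)
  congr 1
  simp [hμ, ha, hb]

/-- Tail moment. -/
def tailMom {d : ℕ} (p R : ℝ) (P : Measure (Euc d)) : ℝ≥0∞ :=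
  ∫⁻ x, {x : Euc d | R < ‖x‖}.indicator (fun x => ENNReal.ofReal (‖x‖ ^ p)) x ∂P

lemma meas_tail {d : ℕ} (p R : ℝ) : Measurable
    ({x : Euc d | R < ‖x‖}.indicator (fun x => ENNReal.ofReal (‖x‖ ^ p))) :=
  Measurable.indicator (by fun_prop) (measurableSet_lt (by fun_prop) (by fun_prop))

lemma tailMom_anti {d : ℕ} (p : ℝ) {R S : ℝ} (h : R ≤ S) (P : Measure (Euc d)) :
    tailMom p S P ≤ tailMom p R P := by
  refine lintegral_mono fun x => ?_
  refine Set.indicator_le_indicator_of_subset ?_ (fun _ => zero_le) x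
  intro y hy
  exact lt_of_le_of_lt h hy

lemma tailMom_small {d : ℕ} {p : ℝ} (P : Measure (Euc d)) (hP : HasFinMom p P) {η : ℝ≥0∞}
    (hη : 0 < η) : ∃ N : ℕ, tailMom p N P ≤ η := by
  have h : Tendsto (fun N : ℕ => tailMom p N P) atTop (𝓝 (∫⁻ _, 0 ∂P)) := by
    refine tendsto_lintegral_of_dominated_convergence
      (fun x => ENNReal.ofReal (‖x‖ ^ p)) (fun n => meas_tail p n) ?_ hP ?_
    · intro n
      exact Eventually.of_forall fun x => Set.indicator_le_self _ _ x
    · refine Eventually.of_forall fun x => ?_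
      obtain ⟨N, hN⟩ := exists_nat_ge ‖x‖
      refine tendsto_const_nhds.congr' ?_
      filter_upwards [eventually_ge_atTop N] with n hn
      rw [Set.indicator_of_notMem]
      simp only [Set.mem_ofPred_eq, not_lt]
      exact hN.trans (by exact_mod_cast hn)
  rw [lintegral_zero] at h
  exact (h.eventually (ge_mem_nhds hη)).exists

lemma tail_pt {d : ℕ} {p R : ℝ} (hp : 1 ≤ p) (x y : Euc d) :
    {x : Euc d | 2 * R < ‖x‖}.indicator (fun x => ENNReal.ofReal (‖x‖ ^ p)) x ≤
      ENNReal.ofReal (2 ^ p) *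
        ({x : Euc d | R < ‖x‖}.indicator (fun x => ENNReal.ofReal (‖x‖ ^ p)) y
          + ENNReal.ofReal (‖x - y‖ ^ p)) := by
  by_cases hx : 2 * R < ‖x‖
  swap
  · rw [Set.indicator_of_notMem (by simpa using hx)]; exact zero_le
  rw [Set.indicator_of_mem (by simpa using hx)]
  have h0 : 0 ≤ p := by linarith
  have gen : ∀ v : ℝ, ‖x‖ ≤ 2 * v → ENNReal.ofReal (‖x‖ ^ p) ≤
      ENNReal.ofReal (2 ^ p) * ENNReal.ofReal (v ^ p) := by
    intro v hv
    have hv0 : 0 ≤ v := by linarith [norm_nonneg x]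
    rw [← ENNReal.ofReal_mul (by positivity), ← Real.mul_rpow (by norm_num) hv0]
    exact ENNReal.ofReal_le_ofReal (Real.rpow_le_rpow (norm_nonneg _) hv h0)
  by_cases hy : ‖x‖ ≤ 2 * ‖y‖
  · have : y ∈ {x : Euc d | R < ‖x‖} := by
      change R < ‖y‖; linarith
    rw [Set.indicator_of_mem this]
    refine (gen _ hy).trans ?_
    gcongr
    exact le_self_add
  · refine (gen ‖x - y‖ ?_).trans ?_
    · have := norm_sub_norm_le x y
      linarith
    · gcongr
      exact le_add_self

lemma tailMom_wp {d : ℕ} {p R : ℝ} (hp : 1 ≤ p) (P Q : Measure (Euc d)) :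
    tailMom p (2 * R) P ≤ ENNReal.ofReal (2 ^ p) * (tailMom p R Q + WpPow p P Q) := by
  have hC0 : ENNReal.ofReal (2 ^ p) ≠ 0 := by
    have : (0:ℝ) < 2 ^ p := by positivity
    simpa using this
  have hC : ENNReal.ofReal (2 ^ p) ≠ ∞ := ENNReal.ofReal_ne_top
  rw [mul_comm (ENNReal.ofReal _), ← ENNReal.div_le_iff hC0 hC]
  unfold WpPow
  simp only [ENNReal.add_iInf]
  refine le_iInf fun γ => le_iInf fun h => ?_
  rw [ENNReal.div_le_iff hC0 hC, mul_comm _ (ENNReal.ofReal _)]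
  obtain ⟨_, h1, h2⟩ := h
  unfold tailMom
  rw [← h1, ← h2, lintegral_map (meas_tail p _) (by fun_prop),
    lintegral_map (meas_tail p _) (by fun_prop),
    ← lintegral_add_right _ (meas_cost p), ← lintegral_const_mul' _ _ hC]
  exact lintegral_mono fun z => tail_pt hp _ _

/-- Discretization. -/
lemma exists_simple (d : ℕ) {R η : ℝ} (hη : 0 < η) :
    ∃ T : SimpleFunc (Euc d) (Euc d), (∀ x, ‖x‖ ≤ R → ‖x - T x‖ ≤ η) ∧
      (∀ x, R < ‖x‖ → T x = 0) := by
  obtain ⟨N, hN⟩ : ∃ N : ℕ, ∀ x : Euc d, ‖x‖ ≤ R →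
      ∃ k ≤ N, dist (TopologicalSpace.denseSeq (Euc d) k) x ≤ η := by
    have hc : IsCompact (Metric.closedBall (0 : Euc d) R) := isCompact_closedBall _ _
    obtain ⟨t, ht⟩ := hc.elim_finite_subcover
      (fun k : ℕ => Metric.ball (TopologicalSpace.denseSeq (Euc d) k) η)
      (fun _ => Metric.isOpen_ball) (by
        intro x _
        obtain ⟨k, hk⟩ := (TopologicalSpace.denseRange_denseSeq (Euc d)).exists_dist_lt x hη
        exact Set.mem_iUnion.2 ⟨k, hk⟩)
    refine ⟨t.sup id, fun x hx => ?_⟩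
    have := ht (show x ∈ Metric.closedBall (0 : Euc d) R by simpa using hx)
    simp only [Set.mem_iUnion, Metric.mem_ball] at this
    obtain ⟨k, hk, h⟩ := this
    exact ⟨k, Finset.le_sup (f := id) hk, by rw [dist_comm]; exact h.le⟩
  refine ⟨SimpleFunc.piecewise (Metric.closedBall (0 : Euc d) R) Metric.isClosed_closedBall.measurableSet
    (SimpleFunc.nearestPt (TopologicalSpace.denseSeq (Euc d)) N) (SimpleFunc.const _ 0), ?_, ?_⟩
  · intro x hx
    obtain ⟨k, hk, h⟩ := hN x hx
    have hx' : x ∈ Metric.closedBall (0 : Euc d) R := by simpa using hx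
    rw [SimpleFunc.piecewise_apply, if_pos hx', ← dist_eq_norm, dist_comm]
    have := SimpleFunc.edist_nearestPt_le (TopologicalSpace.denseSeq (Euc d)) x hk
    rw [edist_dist, edist_dist, ENNReal.ofReal_le_ofReal_iff dist_nonneg] at this
    exact this.trans h
  · intro x hx
    have hx' : x ∉ Metric.closedBall (0 : Euc d) R := by simpa using hx
    rw [SimpleFunc.piecewise_apply, if_neg hx']; rfl

lemma wpPow_disc {d : ℕ} {p R η : ℝ} (hp : 1 ≤ p)
    (T : SimpleFunc (Euc d) (Euc d)) (h1 : ∀ x, ‖x‖ ≤ R → ‖x - T x‖ ≤ η)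
    (h2 : ∀ x, R < ‖x‖ → T x = 0) (P : Measure (Euc d)) [IsProbabilityMeasure P] :
    WpPow p P (P.map T) ≤ ENNReal.ofReal (η ^ p) + tailMom p R P := by
  refine (wpPow_map p P T.measurable).trans ?_
  have : ENNReal.ofReal (η ^ p) = ∫⁻ _, ENNReal.ofReal (η ^ p) ∂P := by simp
  rw [this, tailMom, ← lintegral_add_left measurable_const]
  refine lintegral_mono fun x => ?_
  rcases le_or_gt ‖x‖ R with hx | hx
  · refine le_trans ?_ le_self_add
    exact ENNReal.ofReal_le_ofReal (Real.rpow_le_rpow (norm_nonneg _) (h1 x hx) (by linarith))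
  · refine le_trans ?_ le_add_self
    rw [Set.indicator_of_mem (by simpa using hx), h2 x hx, sub_zero]

lemma empDist_prob {d n : ℕ} (hn : n ≠ 0) (x : Fin n → Euc d) : IsProbabilityMeasure (empDist x) := by
  refine ⟨?_⟩
  simp only [empDist, Measure.coe_smul, Measure.coe_finsetSum, Pi.smul_apply, Finset.sum_apply,
    measure_univ, Finset.sum_const, Finset.card_univ, Fintype.card_fin, smul_eq_mul, nsmul_eq_mul,
    mul_one]
  exact ENNReal.inv_mul_cancel (by exact_mod_cast hn) (by simp)

lemma lintegral_empDist {d n : ℕ} (x : Fin n → Euc d) {f : Euc d → ℝ≥0∞} (hf : Measurable f) :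
    ∫⁻ y, f y ∂(empDist x) = (n : ℝ≥0∞)⁻¹ * ∑ i, f (x i) := by
  rw [empDist, lintegral_smul_measure, lintegral_finsetSum_measure, smul_eq_mul]
  congr 1
  exact Finset.sum_congr rfl fun i _ => lintegral_dirac' _ hf

lemma markov_tail {d n : ℕ} (hn : n ≠ 0) (p R : ℝ) (P : Measure (Euc d)) [IsProbabilityMeasure P]
    {s : ℝ≥0∞} (hs : s ≠ 0) (hs' : s ≠ ∞) :
    prodn P n {x | s < tailMom p R (empDist x)} ≤ tailMom p R P / s := by
  have hm : Measurable fun x : Fin n → Euc d => tailMom p R (empDist x) := by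
    simp only [tailMom, lintegral_empDist _ (meas_tail p R)]
    refine Measurable.const_mul ?_ _
    exact Finset.measurable_fun_sum _ fun i _ => (meas_tail p R).comp (measurable_pi_apply i)
  have hint : ∫⁻ x, tailMom p R (empDist x) ∂(prodn P n) = tailMom p R P := by
    simp only [tailMom, lintegral_empDist _ (meas_tail p R)]
    rw [lintegral_const_mul, lintegral_finsetSum]
    · have : ∀ i : Fin n, ∫⁻ x : Fin n → Euc d, {x : Euc d | R < ‖x‖}.indicator
          (fun x => ENNReal.ofReal (‖x‖ ^ p)) (x i) ∂(prodn P n) = tailMom p R P := by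
        intro i
        have := (measurePreserving_eval (fun _ : Fin n => P) i).lintegral_comp (meas_tail p R)
        exact this
      simp only [this]
      rw [Finset.sum_const, Finset.card_univ, Fintype.card_fin, nsmul_eq_mul, ← mul_assoc,
        ENNReal.inv_mul_cancel (by exact_mod_cast hn) (by simp), one_mul]
      rfl
    · exact fun i _ => (meas_tail p R).comp (measurable_pi_apply i)
    · exact Finset.measurable_fun_sum _ fun i _ => (meas_tail p R).comp (measurable_pi_apply i)
  rw [← hint]
  refine le_trans (measure_mono ?_) (meas_ge_le_lintegral_div hm.aemeasurable hs hs')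
  intro x hx
  simp only [Set.mem_ofPred_eq] at hx ⊢
  exact hx.le

open ProbabilityTheory in
lemma cheb {d n : ℕ} (hn : n ≠ 0) (P : Measure (Euc d)) [IsProbabilityMeasure P]
    {A : Set (Euc d)} (hA : MeasurableSet A) {s : ℝ} (hs : 0 < s) :
    prodn P n {x | ENNReal.ofReal s < empDist x A - P A} ≤ ENNReal.ofReal (1 / (n * s ^ 2)) := by
  have hn0 : (0:ℝ) < n := by exact_mod_cast Nat.pos_of_ne_zero hn
  set f : Euc d → ℝ := A.indicator 1 with hf
  have hfm : Measurable f := measurable_one.indicator hA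
  have hfb : ∀ x, f x ∈ Set.Icc (0:ℝ) 1 := by
    intro x
    by_cases h : x ∈ A <;> simp [hf, h]
  have hL : MemLp f 2 P := by
    refine MemLp.of_bound hfm.aestronglyMeasurable 1 (Eventually.of_forall fun x => ?_)
    rw [Real.norm_eq_abs, abs_of_nonneg (hfb x).1]; exact (hfb x).2
  set X : (Fin n → Euc d) → ℝ := ∑ i, fun ω => f (ω i) with hX
  have hPi : ∀ i : Fin n, MemLp (fun ω : Fin n → Euc d => f (ω i)) 2 (prodn P n) := fun i =>
    hL.comp_measurePreserving (measurePreserving_eval (fun _ : Fin n => P) i)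
  have : IsProbabilityMeasure (prodn P n) := by unfold prodn; infer_instance
  have hXL : MemLp X 2 (prodn P n) := memLp_finsetSum' _ fun i _ => hPi i
  have hvar : variance X (prodn P n) ≤ n := by
    rw [hX, prodn, variance_sum_pi (X := fun _ => f) (fun _ => hL)]
    have : variance f P ≤ ((1 - 0) / 2) ^ 2 :=
      variance_le_sq_of_bounded (Eventually.of_forall hfb) hfm.aemeasurable
    rw [Finset.sum_const, Finset.card_univ, Fintype.card_fin, nsmul_eq_mul]
    nlinarith
  have hmean : ∫ x, X x ∂(prodn P n) = n * P.real A := by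
    simp only [hX, Finset.sum_apply]
    rw [integral_finsetSum _ fun i _ => (hPi i).integrable (by norm_num)]
    have : ∀ i : Fin n, ∫ x : Fin n → Euc d, f (x i) ∂(prodn P n) = P.real A := by
      intro i
      have h := (measurePreserving_eval (fun _ : Fin n => P) i).map_eq
      have h' := integral_map (μ := prodn P n) (φ := fun x => x i)
        (measurable_pi_apply i).aemeasurable (f := f) hfm.aestronglyMeasurable
      rw [← h']
      change ∫ y, f y ∂(Measure.map (Function.eval i) (Measure.pi fun _ => P)) = _
      rw [h, hf, integral_indicator_one hA]
    simp [this]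
  have hc := meas_ge_le_variance_div_sq hXL (c := n * s) (by positivity)
  rw [hmean] at hc
  refine (measure_mono ?_).trans (hc.trans (ENNReal.ofReal_le_ofReal ?_))
  · intro x hx
    simp only [Set.mem_ofPred_eq] at hx ⊢
    have he : empDist x A = ENNReal.ofReal (X x / n) := by
      have h1 : empDist x A = (n : ℝ≥0∞)⁻¹ * ∑ i, A.indicator 1 (x i) := by
        rw [← lintegral_indicator_one hA, lintegral_empDist x (measurable_one.indicator hA)]
      rw [h1, ENNReal.ofReal_div_of_pos hn0, ENNReal.div_eq_inv_mul, ENNReal.ofReal_natCast]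
      congr 1
      simp only [hX, Finset.sum_apply]
      rw [ENNReal.ofReal_sum_of_nonneg fun i _ => (hfb _).1]
      refine Finset.sum_congr rfl fun i _ => ?_
      by_cases h : x i ∈ A <;> simp [hf, h]
    have hPA : P A = ENNReal.ofReal (P.real A) := by simp
    rw [he, hPA, ← ENNReal.ofReal_sub _ measureReal_nonneg, ENNReal.ofReal_lt_ofReal_iff_of_nonneg hs.le] at hx
    refine le_trans ?_ (le_abs_self _)
    have : X x = n * (X x / n) := by field_simp
    rw [this, ← mul_sub]
    exact mul_le_mul_of_nonneg_left hx.le hn0.le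
  · rw [div_le_div_iff₀ (by positivity) (by positivity)]
    nlinarith [mul_le_mul_of_nonneg_right hvar (by positivity : 0 ≤ n * s ^ 2)]

lemma unif_cont {d : ℕ} {p : ℝ} (hp : 1 ≤ p) {Θ : Type*} [MetricSpace Θ]
    (Pfam : Θ → Measure (Euc d))
    (hc : ∀ θ₀ : Θ, ∀ ε > (0 : ℝ), ∃ δ > (0 : ℝ), ∀ θ : Θ,
      dist θ θ₀ < δ → WpPow p (Pfam θ) (Pfam θ₀) ≤ ENNReal.ofReal ε)
    {K : Set Θ} (hK : IsCompact K) {h : ℝ} (hh : 0 < h) :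
    ∃ δ > (0:ℝ), ∀ θ ∈ K, ∀ θ', dist θ' θ < δ → WpPow p (Pfam θ) (Pfam θ') ≤ ENNReal.ofReal h := by
  have hC : (0:ℝ) < 2 ^ (p - 1) := by positivity
  set e := h / (2 * 2 ^ (p - 1)) with he
  have he0 : 0 < e := by positivity
  choose δ hδ hδ' using fun θ₀ => hc θ₀ e he0
  obtain ⟨r, hr, hr'⟩ := lebesgue_number_lemma_of_metric hK (c := fun θ₀ => Metric.ball θ₀ (δ θ₀))
    (fun _ => Metric.isOpen_ball)
    (fun θ _ => Set.mem_iUnion.2 ⟨θ, Metric.mem_ball_self (hδ θ)⟩)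
  refine ⟨r, hr, fun θ hθ θ' hd => ?_⟩
  obtain ⟨θ₀, h₀⟩ := hr' θ hθ
  have a1 := hδ' θ₀ θ (h₀ (Metric.mem_ball_self hr))
  have a2 := hδ' θ₀ θ' (h₀ hd)
  rw [wpPow_symm] at a2
  refine (wpPow_tri hp _ (Pfam θ₀) _).trans ?_
  calc _ ≤ ENNReal.ofReal (2 ^ (p - 1)) * (ENNReal.ofReal e + ENNReal.ofReal e) := by gcongr
    _ = ENNReal.ofReal h := by
      rw [← ENNReal.ofReal_add he0.le he0.le, ← ENNReal.ofReal_mul hC.le]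
      congr 1
      rw [he]; field_simp; ring

lemma unif_tail {d : ℕ} {p : ℝ} (hp : 1 ≤ p) {Θ : Type*} [MetricSpace Θ]
    (Pfam : Θ → Measure (Euc d)) (hmom : ∀ θ, HasFinMom p (Pfam θ))
    (hc : ∀ θ₀ : Θ, ∀ ε > (0 : ℝ), ∃ δ > (0 : ℝ), ∀ θ : Θ,
      dist θ θ₀ < δ → WpPow p (Pfam θ) (Pfam θ₀) ≤ ENNReal.ofReal ε)
    {K : Set Θ} (hK : IsCompact K) {h : ℝ} (hh : 0 < h) :
    ∃ R : ℝ, ∀ θ ∈ K, tailMom p R (Pfam θ) ≤ ENNReal.ofReal h := by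
  have hC : (0:ℝ) < 2 ^ p := by positivity
  set e := h / (2 * 2 ^ p) with he
  have he0 : 0 < e := by positivity
  choose δ hδ hδ' using fun θ₀ => hc θ₀ e he0
  choose N hN using fun θ₀ => tailMom_small (Pfam θ₀) (hmom θ₀) (ENNReal.ofReal_pos.2 he0)
  obtain ⟨t, -, ht⟩ := hK.elim_nhds_subcover (fun θ₀ => Metric.ball θ₀ (δ θ₀))
    (fun θ _ => Metric.ball_mem_nhds _ (hδ θ))
  refine ⟨2 * (t.sup N : ℕ), fun θ hθ => ?_⟩
  have := ht hθ
  simp only [Set.mem_iUnion] at this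
  obtain ⟨θ₀, h₀, hb⟩ := this
  refine (tailMom_wp hp _ (Pfam θ₀)).trans ?_
  calc _ ≤ ENNReal.ofReal (2 ^ p) * (ENNReal.ofReal e + ENNReal.ofReal e) := by
        gcongr
        · refine (tailMom_anti p ?_ _).trans (hN θ₀)
          exact_mod_cast Finset.le_sup h₀
        · exact hδ' θ₀ θ hb
    _ = ENNReal.ofReal h := by
      rw [← ENNReal.ofReal_add he0.le he0.le, ← ENNReal.ofReal_mul hC.le]
      congr 1
      rw [he]; field_simp; ring

/-- Proposition on general parametric families, part (ii).  Under the same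
assumptions as part (i), the critical values
`c_M(α, n, θ) = inf {t ≥ 0 : P_θⁿ[T_{M,n} ≤ t] ≥ 1 - α}` tend to zero uniformly on compact
subsets of `Θ`: for every `α > 0` and compact `K`, `sup_{θ ∈ K} c_M(α, n, θ) → 0`
(equivalently, since the critical values are nonnegative: for every `ε > 0`, eventually
`c_M(α, n, θ) ≤ ε` for all `θ ∈ K`). -/
theorem parametric_critical_values_tendsto_zero_unif {d : ℕ} (p : ℝ) (hp : 1 ≤ p)
    {Θ : Type*} [MetricSpace Θ] [MeasurableSpace Θ] [BorelSpace Θ]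
    (Pfam : Θ → Measure (Euc d))
    (hprob : ∀ θ, IsProbabilityMeasure (Pfam θ))
    (hmom : ∀ θ, HasFinMom p (Pfam θ))
    -- (a) one-to-one and `W_p`-continuous
    (hinj : Function.Injective Pfam)
    (hcont : ∀ θ₀ : Θ, ∀ ε > (0 : ℝ), ∃ δ > (0 : ℝ), ∀ θ : Θ,
      dist θ θ₀ < δ → Wp p (Pfam θ) (Pfam θ₀) < ENNReal.ofReal ε)
    -- measurable estimator
    (est : (n : ℕ) → (Fin n → Euc d) → Θ)
    (hmeas : ∀ n, Measurable (est n))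
    -- (b) weak consistency locally uniformly in `θ`
    (hcons : ∀ ε > (0 : ℝ), ∀ K : Set Θ, IsCompact K →
      Tendsto (fun n : ℕ => ⨆ θ ∈ K, prodn (Pfam θ) n {x | ε < dist (est n x) θ})
        atTop (𝓝 0)) :
    ∀ α > (0 : ℝ), ∀ K : Set Θ, IsCompact K → ∀ ε > (0 : ℝ),
      ∀ᶠ n : ℕ in atTop, ∀ θ ∈ K,
        sInf {t : ℝ | 0 ≤ t ∧
          ENNReal.ofReal (1 - α) ≤
            prodn (Pfam θ) n
              {x | WpPow p (empDist x) (Pfam (est n x)) ≤ ENNReal.ofReal t}}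
          ≤ ε := by
  intro α hα K hK ε hε
  have hp0 : 0 < p := by linarith
  have hc : ∀ θ₀ : Θ, ∀ ε > (0 : ℝ), ∃ δ > (0 : ℝ), ∀ θ : Θ,
      dist θ θ₀ < δ → WpPow p (Pfam θ) (Pfam θ₀) ≤ ENNReal.ofReal ε := by
    intro θ₀ e he
    obtain ⟨δ, hδ, h⟩ := hcont θ₀ (e ^ (1 / p)) (by positivity)
    refine ⟨δ, hδ, fun θ hd => ?_⟩
    have := h θ hd
    rw [Wp, ← ENNReal.ofReal_rpow_of_pos he, ENNReal.rpow_lt_rpow_iff (by positivity)] at this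
    exact this.le
  set C : ℝ := 2 ^ (p - 1) with hCdef
  have hC : 0 < C := by positivity
  set h : ℝ := ε / (2 * C ^ 3 + C ^ 2 + C) with hh
  have h0 : 0 < h := by positivity
  obtain ⟨δ, hδ, hδ'⟩ := unif_cont hp Pfam hc hK h0
  obtain ⟨R, hR⟩ := unif_tail hp Pfam hmom hc hK (h := min (h / 2) (α / 3 * (h / 2)))
    (by positivity)
  set η : ℝ := (h / 2) ^ (1 / p) with hη
  have hη0 : 0 < η := by positivity
  have hηp : η ^ p = h / 2 := by
    rw [hη, ← Real.rpow_mul (by positivity), one_div, inv_mul_cancel₀ hp0.ne', Real.rpow_one]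
  obtain ⟨T, hT1, hT2⟩ := exists_simple d (R := R) hη0
  set D : ℝ := ∑ x ∈ T.range, ∑ y ∈ T.range, ‖x - y‖ ^ p with hD
  have hD0 : 0 ≤ D := Finset.sum_nonneg fun x _ => Finset.sum_nonneg fun y _ => by positivity
  have hDle : ∀ x ∈ T.range, ∀ y ∈ T.range, ENNReal.ofReal (‖x - y‖ ^ p) ≤ ENNReal.ofReal D := by
    intro x hx y hy
    refine ENNReal.ofReal_le_ofReal ?_
    refine (Finset.single_le_sum (f := fun y => ‖x - y‖ ^ p) (fun y _ => by positivity) hy).trans ?_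
    exact Finset.single_le_sum (f := fun x => ∑ y ∈ T.range, ‖x - y‖ ^ p)
      (fun x _ => Finset.sum_nonneg fun y _ => by positivity) hx
  set k : ℝ := (T.range.card : ℝ) with hk
  have hk0 : 0 ≤ k := by positivity
  set s : ℝ := h / ((D + 1) * (k + 1)) with hs
  have hs0 : 0 < s := by positivity
  have hev := (hcons (δ / 2) (by positivity) K hK).eventually
    (ge_mem_nhds (ENNReal.ofReal_pos.2 (by positivity : 0 < α / 3)))
  obtain ⟨N, hN⟩ := exists_nat_ge (k * 3 / (α * s ^ 2))
  filter_upwards [hev, eventually_ge_atTop N, eventually_ge_atTop 1] with n hn1 hn2 hn3 θ hθ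
  have hn : n ≠ 0 := by omega
  have hn0 : (0:ℝ) < n := by exact_mod_cast hn3
  refine csInf_le ⟨0, fun t ht => ht.1⟩ ⟨hε.le, ?_⟩
  have := hprob θ
  have hpn : IsProbabilityMeasure (prodn (Pfam θ) n) := by unfold prodn; infer_instance
  set μ := prodn (Pfam θ) n with hμ
  set B1 : Set (Fin n → Euc d) := {x | ENNReal.ofReal (h / 2) < tailMom p R (empDist x)} with hB1
  set B2 : Set (Fin n → Euc d) := ⋃ j ∈ T.range,
    {x | ENNReal.ofReal s < empDist x (T ⁻¹' {j}) - Pfam θ (T ⁻¹' {j})} with hB2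
  set B3 : Set (Fin n → Euc d) := {x | δ / 2 < dist (est n x) θ} with hB3
  set G : Set (Fin n → Euc d) :=
    {x | WpPow p (empDist x) (Pfam (est n x)) ≤ ENNReal.ofReal ε} with hG
  have m1 : μ B1 ≤ ENNReal.ofReal (α / 3) := by
    refine (markov_tail hn p R (Pfam θ) (ENNReal.ofReal_pos.2 (by positivity)).ne'
      ENNReal.ofReal_ne_top).trans ?_
    refine ENNReal.div_le_of_le_mul ?_
    rw [← ENNReal.ofReal_mul (by positivity)]
    exact (hR θ hθ).trans (ENNReal.ofReal_le_ofReal (min_le_right _ _))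
  have m2 : μ B2 ≤ ENNReal.ofReal (α / 3) := by
    refine (measure_biUnion_finset_le _ _).trans ?_
    refine (Finset.sum_le_sum fun j _ => cheb hn (Pfam θ) (T.measurableSet_preimage {j}) hs0).trans ?_
    rw [Finset.sum_const, nsmul_eq_mul, ← ENNReal.ofReal_natCast, ← ENNReal.ofReal_mul (by positivity)]
    refine ENNReal.ofReal_le_ofReal ?_
    have h1 : k * 3 / (α * s ^ 2) ≤ n := hN.trans (by exact_mod_cast hn2)
    rw [div_le_iff₀ (by positivity)] at h1
    rw [← hk, mul_one_div, div_le_div_iff₀ (by positivity) (by norm_num)]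
    linarith
  have m3 : μ B3 ≤ ENNReal.ofReal (α / 3) :=
    (le_iSup₂ (f := fun θ (_ : θ ∈ K) => prodn (Pfam θ) n {x | δ / 2 < dist (est n x) θ}) θ hθ).trans
      hn1
  have cover : (Set.univ : Set (Fin n → Euc d)) ⊆ G ∪ (B1 ∪ B2 ∪ B3) := by
    intro x _
    by_cases hb : x ∈ B1 ∪ B2 ∪ B3
    · exact Or.inr hb
    left
    have hx1 : x ∉ B1 := fun hx => hb (Or.inl (Or.inl hx))
    have hx2 : x ∉ B2 := fun hx => hb (Or.inl (Or.inr hx))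
    have hx3 : x ∉ B3 := fun hx => hb (Or.inr hx)
    simp only [hB1, Set.mem_ofPred_eq, not_lt] at hx1
    simp only [hB2, Set.mem_iUnion, Set.mem_ofPred_eq, not_exists, not_lt] at hx2
    simp only [hB3, Set.mem_ofPred_eq, not_lt] at hx3
    have hpx := empDist_prob hn x
    have w1 : WpPow p (empDist x) ((empDist x).map T) ≤ ENNReal.ofReal h := by
      refine (wpPow_disc hp T hT1 hT2 (empDist x)).trans ?_
      rw [hηp]
      refine (add_le_add le_rfl hx1).trans ?_
      rw [← ENNReal.ofReal_add (by positivity) (by positivity), add_halves]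
    have w2 : WpPow p (Pfam θ) ((Pfam θ).map T) ≤ ENNReal.ofReal h := by
      refine (wpPow_disc hp T hT1 hT2 (Pfam θ)).trans ?_
      rw [hηp]
      refine (add_le_add le_rfl ((hR θ hθ).trans
        (ENNReal.ofReal_le_ofReal (min_le_left _ _)))).trans ?_
      rw [← ENNReal.ofReal_add (by positivity) (by positivity), add_halves]
    rw [wpPow_symm] at w2
    have w3 : WpPow p ((empDist x).map T) ((Pfam θ).map T) ≤ ENNReal.ofReal h := by
      refine (wpPow_simple hp _ _ T _ hDle).trans ?_
      calc _ ≤ ENNReal.ofReal D * ∑ j ∈ T.range, ENNReal.ofReal s := by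
            gcongr with j hj
            exact hx2 j hj
        _ = ENNReal.ofReal (D * (k * s)) := by
            rw [Finset.sum_const, nsmul_eq_mul, ← ENNReal.ofReal_natCast,
              ← ENNReal.ofReal_mul (by positivity), ← ENNReal.ofReal_mul hD0]
        _ ≤ ENNReal.ofReal h := by
            refine ENNReal.ofReal_le_ofReal ?_
            have : h = (D + 1) * (k + 1) * s := by rw [hs]; field_simp
            rw [this]
            nlinarith [mul_nonneg hD0 hs0.le, mul_nonneg hk0 hs0.le]
    have w4 : WpPow p (Pfam θ) (Pfam (est n x)) ≤ ENNReal.ofReal h :=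
      hδ' θ hθ _ (by linarith)
    have tri : ∀ (P Q S : Measure (Euc d)) (a b : ℝ), 0 ≤ a → 0 ≤ b →
        WpPow p P Q ≤ ENNReal.ofReal a → WpPow p Q S ≤ ENNReal.ofReal b →
        WpPow p P S ≤ ENNReal.ofReal (C * (a + b)) := by
      intro P Q S a b ha hb' h1 h2
      rw [ENNReal.ofReal_mul hC.le, ENNReal.ofReal_add ha hb']
      refine (wpPow_tri hp P Q S).trans ?_
      gcongr
    have f := tri _ _ _ _ _ (by positivity) h0.le
      (tri _ _ _ _ _ h0.le (by positivity) w1 (tri _ _ _ _ _ h0.le h0.le w3 w2)) w4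
    have e : C * (C * (h + C * (h + h)) + h) = ε := by
      have : ε = h * (2 * C ^ 3 + C ^ 2 + C) := by rw [hh]; field_simp
      rw [this]; ring
    rw [e] at f
    exact f
  have tot : 1 ≤ μ G + ENNReal.ofReal α := by
    calc (1 : ℝ≥0∞) = μ Set.univ := measure_univ.symm
      _ ≤ μ (G ∪ (B1 ∪ B2 ∪ B3)) := measure_mono cover
      _ ≤ μ G + (μ B1 + μ B2 + μ B3) := by
          refine (measure_union_le _ _).trans ?_
          gcongr
          refine (measure_union_le _ _).trans ?_
          gcongr
          exact measure_union_le _ _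
      _ ≤ μ G + (ENNReal.ofReal (α / 3) + ENNReal.ofReal (α / 3) + ENNReal.ofReal (α / 3)) := by
          gcongr
      _ = μ G + ENNReal.ofReal α := by
          rw [← ENNReal.ofReal_add (by positivity) (by positivity),
            ← ENNReal.ofReal_add (by positivity) (by positivity)]
          congr 2; ring
  rw [ENNReal.ofReal_sub _ hα.le, ENNReal.ofReal_one]
  exact tsub_le_iff_right.2 tot
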